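/- arXiv:1703.01853 — 15 statements merged into one kernel-verified Lean document; each statement's English description precedes it below -/
import Mathlib

section
/- For every real number a, the antisymmetric bilinear bracket on ℝ⁷ defined on the basis e₁,…,e₇ by [e₁,e₄]=−e₅, [e₁,e₃]=−e₆, [e₂,e₃]=−e₅, [e₂,e₄]=e₆, [e₇,e₁]=a·e₁, [e₇,e₂]=a·e₂, [e₇,e₃]=(1/2−a)·e₃, [e₇,e₄]=(1/2−a)·e₄, [e₇,e₅]=(1/2)·e₅, [e₇,e₆]=(1/2)·e₆ (all other brackets of basis vectors zero) satisfies the Jacobi identity; the resulting Lie algebra g_a is solvable, and the subspace h = span(e₁,…,e₆) is a 2-step nilpotent ideal of g_a (i.e. [h,h] ≠ 0 and [h,[h,h]] = 0, for all a). -/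
/-- The bracket of the solvable Lie algebra `g_a` on `ℝ⁷` (basis `e₁,…,e₇` ↦ indices `0,…,6`):
`[e₁,e₄]=−e₅`, `[e₁,e₃]=−e₆`, `[e₂,e₃]=−e₅`, `[e₂,e₄]=e₆`, and `ad e₇` acts diagonally with
eigenvalues `(a, a, 1/2−a, 1/2−a, 1/2, 1/2)` on `e₁,…,e₆`, extended bilinearly. -/
noncomputable def gABracket (a : ℝ) (x y : Fin 7 → ℝ) : Fin 7 → ℝ :=
  ![a * (x 6 * y 0 - x 0 * y 6),
    a * (x 6 * y 1 - x 1 * y 6),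
    (1/2 - a) * (x 6 * y 2 - x 2 * y 6),
    (1/2 - a) * (x 6 * y 3 - x 3 * y 6),
    -(x 0 * y 3 - x 3 * y 0) - (x 1 * y 2 - x 2 * y 1) + (1/2) * (x 6 * y 4 - x 4 * y 6),
    -(x 0 * y 2 - x 2 * y 0) + (x 1 * y 3 - x 3 * y 1) + (1/2) * (x 6 * y 5 - x 5 * y 6),
    0]

theorem gABracket_apply_six (a : ℝ) (x y : Fin 7 → ℝ) : gABracket a x y 6 = 0 := rfl

theorem gABracket_antisymm (a : ℝ) (x y : Fin 7 → ℝ) :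
    gABracket a x y = -gABracket a y x := by
  ext i
  fin_cases i <;> simp [gABracket] <;> ring

theorem gABracket_jacobi (a : ℝ) (x y z : Fin 7 → ℝ) :
    gABracket a (gABracket a x y) z + gABracket a (gABracket a y z) x +
      gABracket a (gABracket a z x) y = 0 := by
  ext i
  fin_cases i <;> simp [gABracket] <;> ring

theorem gABracket_gABracket_eq_zero (a : ℝ) {x y z : Fin 7 → ℝ}
    (hx : x 6 = 0) (hy : y 6 = 0) (hz : z 6 = 0) :
    gABracket a x (gABracket a y z) = 0 := by
  ext i
  fin_cases i <;> simp [gABracket, hx, hy, hz]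

theorem exists_gABracket_ne_zero (a : ℝ) :
    ∃ x y : Fin 7 → ℝ, x 6 = 0 ∧ y 6 = 0 ∧ gABracket a x y ≠ 0 := by
  refine ⟨Pi.single 0 1, Pi.single 3 1, by simp, by simp, fun h => ?_⟩
  simpa [gABracket] using congrFun h 4

/-- For every real `a`, the bracket of `g_a` satisfies the Jacobi identity
(and is antisymmetric), the resulting Lie algebra is solvable (its derived series terminates
at zero: already the third derived algebra vanishes), and the subspace
`h = span(e₁,…,e₆) = {x | x 6 = 0}` is a 2-step nilpotent ideal: brackets land in `h`,
`[h,h] ≠ 0` and `[h,[h,h]] = 0`. -/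
theorem stmt_0 (a : ℝ) :
    -- antisymmetry
    (∀ x y : Fin 7 → ℝ, gABracket a x y = - gABracket a y x) ∧
    -- Jacobi identity
    (∀ x y z : Fin 7 → ℝ,
      gABracket a (gABracket a x y) z + gABracket a (gABracket a y z) x +
        gABracket a (gABracket a z x) y = 0) ∧
    -- solvability: the derived series terminates at zero (derived length ≤ 3)
    (∀ x₁ x₂ x₃ x₄ x₅ x₆ x₇ x₈ : Fin 7 → ℝ,
      gABracket a (gABracket a (gABracket a x₁ x₂) (gABracket a x₃ x₄))
        (gABracket a (gABracket a x₅ x₆) (gABracket a x₇ x₈)) = 0) ∧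
    -- h = {x | x 6 = 0} is an ideal (indeed all brackets land in h)
    (∀ x y : Fin 7 → ℝ, y 6 = 0 → (gABracket a x y) 6 = 0) ∧
    -- [h,h] ≠ 0
    (∃ x y : Fin 7 → ℝ, x 6 = 0 ∧ y 6 = 0 ∧ gABracket a x y ≠ 0) ∧
    -- [h,[h,h]] = 0, so h is 2-step nilpotent
    (∀ x y z : Fin 7 → ℝ, x 6 = 0 → y 6 = 0 → z 6 = 0 →
      gABracket a x (gABracket a y z) = 0) := by
  exact ⟨gABracket_antisymm a, gABracket_jacobi a,
    fun _ _ _ _ _ _ _ _ => gABracket_gABracket_eq_zero a (gABracket_apply_six ..)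
      (gABracket_apply_six ..) (gABracket_apply_six ..),
    fun x y _ => gABracket_apply_six a x y, exists_gABracket_ne_zero a,
    fun _ _ _ => gABracket_gABracket_eq_zero a⟩
end

section
/- For every real number a, the diagonal endomorphism D_a = Diag(−2+2a², −2+2a², −3/2−2a+2a², −3/2−2a+2a², −7/2−2a+4a², −7/2−2a+4a², 0) of ℝ⁷ (with respect to the basis e₁,…,e₇) is a derivation of the Lie algebra g_a, and the diagonal matrix Q(a) = Diag(−2/3+4/3·a−2/3·a², −2/3+4/3·a−2/3·a², −1/6−2/3·a−2/3·a², −1/6−2/3·a−2/3·a², −13/6−2/3·a+4/3·a², −13/6−2/3·a+4/3·a², 4/3+4/3·a−8/3·a²) satisfies Q(a) = c(a)·I + D_a, where c(a) = 4/3 + 4/3·a − 8/3·a². -/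
/-- The diagonal endomorphism
`D_a = Diag(−2+2a², −2+2a², −3/2−2a+2a², −3/2−2a+2a², −7/2−2a+4a², −7/2−2a+4a², 0)` of `ℝ⁷`. -/
noncomputable def DA (a : ℝ) (x : Fin 7 → ℝ) : Fin 7 → ℝ :=
  ![(-2 + 2*a^2) * x 0, (-2 + 2*a^2) * x 1,
    (-3/2 - 2*a + 2*a^2) * x 2, (-3/2 - 2*a + 2*a^2) * x 3,
    (-7/2 - 2*a + 4*a^2) * x 4, (-7/2 - 2*a + 4*a^2) * x 5, 0]

/-- The diagonal operator
`Q(a) = Diag(−2/3+4/3a−2/3a², −2/3+4/3a−2/3a², −1/6−2/3a−2/3a², −1/6−2/3a−2/3a²,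
−13/6−2/3a+4/3a², −13/6−2/3a+4/3a², 4/3+4/3a−8/3a²)` of `ℝ⁷`. -/
noncomputable def QA (a : ℝ) (x : Fin 7 → ℝ) : Fin 7 → ℝ :=
  ![(-2/3 + 4/3*a - 2/3*a^2) * x 0, (-2/3 + 4/3*a - 2/3*a^2) * x 1,
    (-1/6 - 2/3*a - 2/3*a^2) * x 2, (-1/6 - 2/3*a - 2/3*a^2) * x 3,
    (-13/6 - 2/3*a + 4/3*a^2) * x 4, (-13/6 - 2/3*a + 4/3*a^2) * x 5,
    (4/3 + 4/3*a - 8/3*a^2) * x 6]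

/-- For every real `a`, `D_a` is a derivation of `g_a`, and
`Q(a) = c(a)·I + D_a` where `c(a) = 4/3 + 4/3·a − 8/3·a²`. -/
theorem stmt_1 (a : ℝ) :
    (∀ x y : Fin 7 → ℝ,
      DA a (gABracket a x y) = gABracket a (DA a x) y + gABracket a x (DA a y)) ∧
    (∀ x : Fin 7 → ℝ, QA a x = (4/3 + 4/3*a - 8/3*a^2) • x + DA a x) := by
  constructor
  · intro x y
    ext i
    fin_cases i <;> simp [DA, gABracket] <;> ring
  · intro x
    ext i
    fin_cases i <;> simp [DA, QA] <;> ring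
end

section
/- The polynomial p(a) = 16a⁴ − 16a³ + 28a² − 12a + 11 is strictly positive for all real a, and the function F(a) = (−4a² + 2a − 7)² / (16a⁴ − 16a³ + 28a² − 12a + 11) is strictly decreasing on the interval [1/4, ∞). -/
/-- The function `q ↦ q² / ((q - 4)² + 2)` is strictly decreasing on `[9/2, ∞)`. -/
lemma strictAntiOn_sq_div_sub_four_sq_add_two :
    StrictAntiOn (fun q : ℝ => q ^ 2 / ((q - 4) ^ 2 + 2)) (Set.Ici (9 / 2)) := by
  intro q hq r hr hqr
  rw [Set.mem_Ici] at hq hr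
  have key : 0 < 8 * (q * r) - 18 * (q + r) := by nlinarith
  change r ^ 2 / ((r - 4) ^ 2 + 2) < q ^ 2 / ((q - 4) ^ 2 + 2)
  rw [div_lt_div_iff₀ (by positivity) (by positivity)]
  linarith [mul_pos (sub_pos.2 hqr) key]

/-- The polynomial `p(a) = 16a⁴ − 16a³ + 28a² − 12a + 11` is strictly
positive for all real `a`, and `F(a) = (−4a² + 2a − 7)² / p(a)` is strictly decreasing on
`[1/4, ∞)`. -/
theorem stmt_3 :
    (∀ a : ℝ, 0 < 16*a^4 - 16*a^3 + 28*a^2 - 12*a + 11) ∧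
    StrictAntiOn
      (fun a : ℝ => (-4*a^2 + 2*a - 7)^2 / (16*a^4 - 16*a^3 + 28*a^2 - 12*a + 11))
      (Set.Ici (1/4 : ℝ)) := by
  have hp (a : ℝ) : 16*a^4 - 16*a^3 + 28*a^2 - 12*a + 11 = ((4*a^2 - 2*a + 7) - 4)^2 + 2 := by
    ring
  have hq (a : ℝ) : (-4*a^2 + 2*a - 7)^2 = (4*a^2 - 2*a + 7)^2 := by ring
  simp only [hp, hq]
  refine ⟨fun a => by positivity, fun a ha b hb hab => ?_⟩
  rw [Set.mem_Ici] at ha hb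
  refine strictAntiOn_sq_div_sub_four_sq_add_two ?_ ?_ ?_
  · rw [Set.mem_Ici]
    nlinarith [sq_nonneg (a - 1/4)]
  · rw [Set.mem_Ici]
    nlinarith [sq_nonneg (b - 1/4)]
  · nlinarith
end

section
/- Let F(a) = (−4a² + 2a − 7)² / (16a⁴ − 16a³ + 28a² − 12a + 11). Then F(1/4) = 81/17, F(1) = 3, F(a) tends to 1 as a → ∞, F(a) > 1 for every real a, and for a ∈ [1/4, ∞) one has F(a) > 3 if and only if 1/4 ≤ a < 1. -/
/-- The invariant `F(a) = R²/|Ric|²` of the closed `G₂`-structure on the solvable Lie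
group `G_a`. -/
noncomputable def Fratio (a : ℝ) : ℝ :=
  (-4*a^2 + 2*a - 7)^2 / (16*a^4 - 16*a^3 + 28*a^2 - 12*a + 11)

theorem Fratio_eq (a : ℝ) :
    Fratio a = (4*a^2 - 2*a + 7)^2 / ((4*a^2 - 2*a + 3)^2 + 2) := by
  unfold Fratio
  congr 1 <;> ring

theorem one_lt_Fratio (a : ℝ) : 1 < Fratio a := by
  rw [Fratio_eq, one_lt_div (by positivity)]
  nlinarith [sq_nonneg (4*a - 1)]

theorem Fratio_le_one_add {a : ℝ} (ha : 1 ≤ a) : Fratio a ≤ 1 + 22 / a := by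
  have ha₀ : 0 < a := by linarith
  obtain ⟨t, ht⟩ : ∃ t, t = 4*a^2 - 2*a + 3 := ⟨_, rfl⟩
  have hat : a ≤ t := by nlinarith
  have hnum : 4*a^2 - 2*a + 7 = t + 4 := by rw [ht]; ring
  rw [Fratio_eq, hnum, ← ht, one_add_div ha₀.ne', div_le_div_iff₀ (by positivity) ha₀]
  nlinarith [mul_nonneg (sub_nonneg.2 hat) (by linarith : (0 : ℝ) ≤ 8*t + 14)]

theorem tendsto_Fratio_atTop : Filter.Tendsto Fratio Filter.atTop (nhds 1) := by
  have hupper : Filter.Tendsto (fun a : ℝ => 1 + 22 / a) Filter.atTop (nhds 1) := by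
    simpa using (Filter.tendsto_id.const_div_atTop (22 : ℝ)).const_add 1
  refine tendsto_of_tendsto_of_tendsto_of_le_of_le' tendsto_const_nhds hupper
    (.of_forall fun a => (one_lt_Fratio a).le) ?_
  filter_upwards [Filter.eventually_ge_atTop 1] with a ha using Fratio_le_one_add ha

theorem three_lt_Fratio_iff {a : ℝ} (ha : 0 ≤ a) : 3 < Fratio a ↔ a < 1 := by
  have hfactor : (4*a^2 - 2*a + 7)^2 - 3 * ((4*a^2 - 2*a + 3)^2 + 2)
      = (1 - a) * (8 * (4*a^3 + 3*a + 2)) := by ring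
  rw [Fratio_eq, lt_div_iff₀ (by positivity), ← sub_pos, hfactor,
    mul_pos_iff_of_pos_right (by positivity), sub_pos]

/-- `F(1/4) = 81/17`, `F(1) = 3`, `F(a) → 1` as `a → ∞`, `F(a) > 1` for
every real `a`, and for `a ∈ [1/4, ∞)` one has `F(a) > 3 ↔ a < 1`. -/
theorem stmt_4 :
    Fratio (1/4) = 81/17 ∧
    Fratio 1 = 3 ∧
    Filter.Tendsto Fratio Filter.atTop (nhds 1) ∧
    (∀ a : ℝ, 1 < Fratio a) ∧
    (∀ a : ℝ, 1/4 ≤ a → (3 < Fratio a ↔ a < 1)) := by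
  refine ⟨by norm_num [Fratio], by norm_num [Fratio], tendsto_Fratio_atTop, one_lt_Fratio,
    fun a ha => three_lt_Fratio_iff (by linarith)⟩
end

section
/- For a, b ∈ [1/4, ∞), the Lie algebras g_a and g_b are isomorphic (as real Lie algebras) if and only if a = b. -/
/-- The adjoint map `y ↦ [x, y]` of `g_a`. -/
noncomputable def gAAd (a : ℝ) (x : Fin 7 → ℝ) : Module.End ℝ (Fin 7 → ℝ) where
  toFun := gABracket a x
  map_add' y z := by
    ext i
    fin_cases i <;> simp [gABracket] <;> ring
  map_smul' c y := by
    ext i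
    fin_cases i <;> simp [gABracket] <;> ring

lemma trace_eq_sum_apply_single {n : Type*} [Fintype n] [DecidableEq n]
    (f : Module.End ℝ (n → ℝ)) :
    LinearMap.trace ℝ (n → ℝ) f = ∑ i, f (Pi.single i 1) i := by
  rw [LinearMap.trace_eq_matrix_trace ℝ (Pi.basisFun ℝ n)]
  simp [Matrix.trace]

lemma trace_gAAd (a : ℝ) (x : Fin 7 → ℝ) :
    LinearMap.trace ℝ (Fin 7 → ℝ) (gAAd a x) = 2 * x 6 := by
  rw [trace_eq_sum_apply_single]
  simp [Fin.sum_univ_succ, gAAd, gABracket, Pi.single_apply]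
  ring

lemma trace_gAAd_mul_self (a : ℝ) (x : Fin 7 → ℝ) :
    LinearMap.trace ℝ (Fin 7 → ℝ) (gAAd a x * gAAd a x) =
      (2 * a ^ 2 + 2 * (1 / 2 - a) ^ 2 + 1 / 2) * x 6 ^ 2 := by
  rw [trace_eq_sum_apply_single]
  simp [Fin.sum_univ_succ, gAAd, gABracket, Pi.single_apply]
  ring

/-- For `a, b ∈ [1/4, ∞)`, the Lie algebras `g_a` and `g_b` are
isomorphic as real Lie algebras (i.e. there is a linear equivalence of `ℝ⁷`
intertwining the brackets) if and only if `a = b`. -/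
theorem stmt_5 (a b : ℝ) (ha : 1/4 ≤ a) (hb : 1/4 ≤ b) :
    (∃ e : (Fin 7 → ℝ) ≃ₗ[ℝ] (Fin 7 → ℝ),
      ∀ x y : Fin 7 → ℝ, e (gABracket a x y) = gABracket b (e x) (e y)) ↔ a = b := by
  constructor
  · rintro ⟨e, he⟩
    have hconj (x : Fin 7 → ℝ) : e.conj (gAAd a x) = gAAd b (e x) := by
      refine LinearMap.ext fun y => ?_
      simp [LinearEquiv.conj_apply, gAAd, he]
    have htrace (x : Fin 7 → ℝ) : e x 6 = x 6 := by
      have h := LinearMap.trace_conj' (gAAd a x) e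
      rw [hconj, trace_gAAd, trace_gAAd] at h
      linarith
    have h := LinearMap.trace_conj' (gAAd a (Pi.single 6 1) * gAAd a (Pi.single 6 1)) e
    rw [Module.End.mul_eq_comp, LinearEquiv.conj_comp, hconj, ← Module.End.mul_eq_comp,
      ← Module.End.mul_eq_comp, trace_gAAd_mul_self, trace_gAAd_mul_self, htrace,
      Pi.single_eq_same] at h
    have hprod : (a - b) * (a + b - 1 / 2) = 0 := by linarith
    rcases mul_eq_zero.mp hprod with h | h <;> linarith
  · rintro rfl
    exact ⟨LinearEquiv.refl ℝ _, fun _ _ => rfl⟩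
end

section
/- For every real number a, the Lie algebras g_a and g_{1/2−a} are isomorphic as real Lie algebras. -/
/-- The linear involution of `ℝ⁷` interchanging the planes `⟨e₁,e₂⟩` and `⟨e₃,e₄⟩`, negating
`⟨e₅,e₆⟩` and fixing `e₇`. -/
def planeSwap : (Fin 7 → ℝ) ≃ₗ[ℝ] (Fin 7 → ℝ) :=
  LinearEquiv.ofInvolutive
    { toFun := fun x => ![x 2, x 3, x 0, x 1, -x 4, -x 5, x 6]
      map_add' := fun x y => by
        ext i; fin_cases i <;> simp [add_comm]
      map_smul' := fun c x => by
        ext i; fin_cases i <;> simp }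
    (fun x => by ext i; fin_cases i <;> simp)

theorem planeSwap_apply (x : Fin 7 → ℝ) :
    planeSwap x = ![x 2, x 3, x 0, x 1, -x 4, -x 5, x 6] := rfl

/-- For every real `a`, the Lie algebras `g_a` and `g_{1/2−a}` are
isomorphic as real Lie algebras. -/
theorem stmt_6 (a : ℝ) :
    ∃ e : (Fin 7 → ℝ) ≃ₗ[ℝ] (Fin 7 → ℝ),
      ∀ x y : Fin 7 → ℝ, e (gABracket a x y) = gABracket (1/2 - a) (e x) (e y) := by
  refine ⟨planeSwap, fun x y => ?_⟩
  ext i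
  fin_cases i <;> simp [planeSwap_apply, gABracket] <;> ring
end

section
/- Define H : ℝ³ → ℝ by H(a,b,c) = (1/3)(a² + b² + c²)² − (a⁴ + b⁴ + c⁴), and V : ℝ³ → ℝ³ by V(a,b,c) = ((−4a² + (4/3)(a²+b²+c²))·a, (−4b² + (4/3)(a²+b²+c²))·b, (−4c² + (4/3)(a²+b²+c²))·c). Then V is the gradient of H with respect to the standard inner product on ℝ³, i.e. for every point x ∈ ℝ³, ∇H(x) = V(x). -/
/-- `H(a,b,c) = (1/3)(a² + b² + c²)² − (a⁴ + b⁴ + c⁴)` on euclidean `ℝ³`. -/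
noncomputable def Hfun (x : EuclideanSpace ℝ (Fin 3)) : ℝ :=
  (1/3) * (x 0 ^ 2 + x 1 ^ 2 + x 2 ^ 2)^2 - (x 0 ^ 4 + x 1 ^ 4 + x 2 ^ 4)

/-- The bracket flow vector field
`V(a,b,c) = ((−4a² + (4/3)(a²+b²+c²))a, (−4b² + (4/3)(a²+b²+c²))b, (−4c² + (4/3)(a²+b²+c²))c)`. -/
noncomputable def Vfield (x : EuclideanSpace ℝ (Fin 3)) : EuclideanSpace ℝ (Fin 3) :=
  (WithLp.equiv 2 (Fin 3 → ℝ)).symm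
    ![(-4 * (x 0)^2 + (4/3) * ((x 0)^2 + (x 1)^2 + (x 2)^2)) * x 0,
      (-4 * (x 1)^2 + (4/3) * ((x 0)^2 + (x 1)^2 + (x 2)^2)) * x 1,
      (-4 * (x 2)^2 + (4/3) * ((x 0)^2 + (x 1)^2 + (x 2)^2)) * x 2]

/-- `V` is the gradient of `H` with respect to the standard inner
product on `ℝ³`: at every point `x`, `∇H(x) = V(x)`. -/
theorem stmt_10 (x : EuclideanSpace ℝ (Fin 3)) : HasGradientAt Hfun (Vfield x) x := by
  rw [hasGradientAt_iff_hasFDerivAt]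
  have h (i : Fin 3) :
      HasFDerivAt (fun y : EuclideanSpace ℝ (Fin 3) => y i)
        (EuclideanSpace.proj i : EuclideanSpace ℝ (Fin 3) →L[ℝ] ℝ) x :=
    (EuclideanSpace.proj i : EuclideanSpace ℝ (Fin 3) →L[ℝ] ℝ).hasFDerivAt
  refine HasFDerivAt.congr_fderiv
    ((((((h 0).pow 2).add ((h 1).pow 2)).add ((h 2).pow 2)).pow 2).const_mul (1 / 3) |>.sub
      ((((h 0).pow 4).add ((h 1).pow 4)).add ((h 2).pow 4))) ?_
  ext y
  simp [Vfield, PiLp.inner_apply, Fin.sum_univ_three]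
  ring
end

section
/- Let V : ℝ³ → ℝ³ be V(a,b,c) = ((−4a² + (4/3)(a²+b²+c²))·a, (−4b² + (4/3)(a²+b²+c²))·b, (−4c² + (4/3)(a²+b²+c²))·c) and f(a,b,c) = (a²+b²+c²)². If γ : I → ℝ³ is a differentiable solution of γ'(t) = V(γ(t)) on an interval I, then t ↦ f(γ(t)) has nonpositive derivative at every t ∈ I; in particular f∘γ is nonincreasing on I. -/
/-- The bracket flow vector field
`V(a,b,c) = ((−4a² + (4/3)(a²+b²+c²))a, (−4b² + (4/3)(a²+b²+c²))b, (−4c² + (4/3)(a²+b²+c²))c)`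
on `ℝ³`. -/
noncomputable def V3 (x : Fin 3 → ℝ) : Fin 3 → ℝ :=
  ![(-4 * (x 0)^2 + (4/3) * ((x 0)^2 + (x 1)^2 + (x 2)^2)) * x 0,
    (-4 * (x 1)^2 + (4/3) * ((x 0)^2 + (x 1)^2 + (x 2)^2)) * x 1,
    (-4 * (x 2)^2 + (4/3) * ((x 0)^2 + (x 1)^2 + (x 2)^2)) * x 2]

/-- `f(a,b,c) = (a² + b² + c²)²`. -/
noncomputable def f3 (x : Fin 3 → ℝ) : ℝ := ((x 0)^2 + (x 1)^2 + (x 2)^2)^2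

/-- The derivative of `f3` along a curve with velocity `V3` is `16 (a² + b² + c²) H(a,b,c)`. -/
theorem hasDerivAt_f3_comp {γ : ℝ → Fin 3 → ℝ} {t : ℝ} (h : HasDerivAt γ (V3 (γ t)) t) :
    HasDerivAt (fun s => f3 (γ s))
      (16 * ((γ t 0) ^ 2 + (γ t 1) ^ 2 + (γ t 2) ^ 2) *
        ((1 / 3) * ((γ t 0) ^ 2 + (γ t 1) ^ 2 + (γ t 2) ^ 2) ^ 2 -
          ((γ t 0) ^ 4 + (γ t 1) ^ 4 + (γ t 2) ^ 4))) t := by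
  have hc := hasDerivAt_pi.1 h
  have key := ((((hc 0).fun_pow 2).fun_add ((hc 1).fun_pow 2)).fun_add
    ((hc 2).fun_pow 2)).fun_pow 2
  refine key.congr_deriv ?_
  simp [V3]
  ring

theorem third_sq_sum_sq_sub_sum_pow_four_nonpos (a b c : ℝ) :
    (1 / 3) * (a ^ 2 + b ^ 2 + c ^ 2) ^ 2 - (a ^ 4 + b ^ 4 + c ^ 4) ≤ 0 := by
  nlinarith [sq_nonneg (a ^ 2 - b ^ 2), sq_nonneg (b ^ 2 - c ^ 2), sq_nonneg (a ^ 2 - c ^ 2)]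

/-- If `γ` is a differentiable solution of `γ' = V(γ)` on an interval
`I`, then `t ↦ f(γ(t))` has nonpositive derivative at every `t ∈ I`; in particular
`f ∘ γ` is nonincreasing on `I`. -/
theorem stmt_11 (I : Set ℝ) (hI : I.OrdConnected) (γ : ℝ → Fin 3 → ℝ)
    (hγ : ∀ t ∈ I, HasDerivAt γ (V3 (γ t)) t) :
    (∀ t ∈ I, ∃ d : ℝ, d ≤ 0 ∧ HasDerivAt (fun s => f3 (γ s)) d t) ∧
    AntitoneOn (fun s => f3 (γ s)) I := by
  have hd : ∀ t ∈ I, ∃ d : ℝ, d ≤ 0 ∧ HasDerivAt (fun s => f3 (γ s)) d t := fun t ht =>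
    ⟨_, mul_nonpos_of_nonneg_of_nonpos (by positivity)
      (third_sq_sum_sq_sub_sum_pow_four_nonpos _ _ _), hasDerivAt_f3_comp (hγ t ht)⟩
  refine ⟨hd, antitoneOn_of_deriv_nonpos hI.convex ?_ ?_ ?_⟩
  · intro t ht
    obtain ⟨d, -, h⟩ := hd t ht
    exact h.continuousAt.continuousWithinAt
  · intro t ht
    obtain ⟨d, -, h⟩ := hd t (interior_subset ht)
    exact h.differentiableAt.differentiableWithinAt
  · intro t ht
    obtain ⟨d, hd0, h⟩ := hd t (interior_subset ht)
    exact h.deriv.trans_le hd0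
end

section
/- Let V : ℝ³ → ℝ³ be V(a,b,c) = ((−4a² + (4/3)(a²+b²+c²))·a, (−4b² + (4/3)(a²+b²+c²))·b, (−4c² + (4/3)(a²+b²+c²))·c). For every initial point x₀ ∈ ℝ³ there exists a differentiable curve γ : [0,∞) → ℝ³ with γ(0) = x₀ and γ'(t) = V(γ(t)) for all t ≥ 0. -/
open Set Metric Topology
open scoped NNReal

/-- A bounded, globally Lipschitz vector field on a Banach space has a global integral curve
through every point. -/
theorem exists_global_integralCurve {E : Type*} [NormedAddCommGroup E] [NormedSpace ℝ E]
    [CompleteSpace E] {W : E → E} {K : ℝ≥0} (hK : LipschitzWith K W) {C : ℝ}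
    (hC : ∀ x, ‖W x‖ ≤ C) (x₀ : E) :
    ∃ γ : ℝ → E, γ 0 = x₀ ∧ ∀ t, HasDerivAt γ (W (γ t)) t := by
  lift C to ℝ≥0 using (norm_nonneg _).trans (hC x₀)
  have local_curve : ∀ T : ℝ, ∃ α : ℝ → E, α 0 = x₀ ∧
      ∀ t ∈ Ioo (-T) T, HasDerivAt α (W (α t)) t := by
    intro T
    rcases le_or_gt T 0 with hT | hT
    · exact ⟨fun _ ↦ x₀, rfl, fun t ht ↦ absurd (ht.1.trans ht.2) (by linarith)⟩
    · have hpl : IsPicardLindelof (fun _ ↦ W) (⟨0, by constructor <;> linarith⟩ : Icc (-T) T)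
          x₀ (C * T.toNNReal) 0 C K :=
        .of_time_independent (fun x _ ↦ hC x) hK.lipschitzOnWith (by simp [hT.le])
      obtain ⟨α, hα0, hα⟩ := hpl.exists_eq_forall_mem_Icc_hasDerivWithinAt₀
      exact ⟨α, hα0, fun t ht ↦
        (hα t (Ioo_subset_Icc_self ht)).hasDerivAt (Icc_mem_nhds ht.1 ht.2)⟩
  choose α hα0 hα using local_curve
  have agree : ∀ {S T : ℝ}, 0 < S → S ≤ T → EqOn (α S) (α T) (Ioo (-S) S) := by
    intro S T hS hST
    exact ODE_solution_unique_of_mem_Ioo (v := fun _ ↦ W) (s := fun _ ↦ univ) (t₀ := 0)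
      (fun _ _ ↦ hK.lipschitzOnWith) ⟨by linarith, hS⟩
      (fun t ht ↦ ⟨hα S t ht, mem_univ _⟩)
      (fun t ht ↦ ⟨hα T t ⟨by linarith [ht.1], by linarith [ht.2]⟩, mem_univ _⟩)
      ((hα0 S).trans (hα0 T).symm)
  refine ⟨fun t ↦ α (|t| + 1) t, hα0 _, fun t ↦ ?_⟩
  have ht : t ∈ Ioo (-(|t| + 1)) (|t| + 1) := abs_lt.mp (lt_add_one _)
  refine (hα _ t ht).congr_of_eventuallyEq ?_
  filter_upwards [Ioo_mem_nhds ht.1 ht.2] with s hs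
  have hs' : s ∈ Ioo (-(|s| + 1)) (|s| + 1) := abs_lt.mp (lt_add_one _)
  rcases le_total (|s| + 1) (|t| + 1) with h | h
  · exact agree (by positivity) h hs'
  · exact (agree (by positivity) h hs).symm

theorem contDiff_V3 {n : WithTop ℕ∞} : ContDiff ℝ n V3 := by
  rw [contDiff_pi]
  intro i
  fin_cases i <;> simp only [V3] <;> simp <;> fun_prop

theorem sum_mul_V3_nonpos (x : Fin 3 → ℝ) : ∑ i, x i * V3 x i ≤ 0 := by
  simp only [Fin.sum_univ_three, V3, Matrix.cons_val]
  nlinarith [sq_nonneg ((x 0)^2 - (x 1)^2), sq_nonneg ((x 1)^2 - (x 2)^2),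
    sq_nonneg ((x 0)^2 - (x 2)^2)]

theorem antitone_sum_sq_of_integralCurve {W : (Fin 3 → ℝ) → Fin 3 → ℝ}
    (hW : ∀ x, ∑ i, x i * W x i ≤ 0) {γ : ℝ → Fin 3 → ℝ}
    (hγ : ∀ t, HasDerivAt γ (W (γ t)) t) : Antitone fun t ↦ ∑ i, γ t i ^ 2 := by
  have hderiv : ∀ t, HasDerivAt (fun t ↦ ∑ i, γ t i ^ 2) (2 * ∑ i, γ t i * W (γ t) i) t := by
    intro t
    rw [Finset.mul_sum]
    refine HasDerivAt.fun_sum fun i _ ↦ ?_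
    exact ((hasDerivAt_pi.mp (hγ t) i).fun_pow 2).congr_deriv (by push_cast; ring)
  refine antitone_of_deriv_nonpos (fun t ↦ (hderiv t).differentiableAt) fun t ↦ ?_
  rw [(hderiv t).deriv]
  linarith [hW (γ t)]

theorem norm_le_one_add_sum_sq {ι : Type*} [Fintype ι] (x : ι → ℝ) : ‖x‖ ≤ 1 + ∑ i, x i ^ 2 := by
  have hS : 0 ≤ ∑ i, x i ^ 2 := Finset.sum_nonneg fun i _ ↦ sq_nonneg _
  refine (pi_norm_le_iff_of_nonneg (by positivity)).mpr fun i ↦ abs_le_of_sq_le_sq ?_ (by positivity)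
  have := Finset.single_le_sum (fun j _ ↦ sq_nonneg (x j)) (Finset.mem_univ i)
  nlinarith

/-- For every initial point `x₀ ∈ ℝ³` there is a differentiable curve
`γ` defined for all `t ≥ 0` with `γ(0) = x₀` and `γ'(t) = V(γ(t))` for all `t ≥ 0`
(forward-global existence: the bracket flow solutions are immortal). -/
theorem stmt_12 (x₀ : Fin 3 → ℝ) :
    ∃ γ : ℝ → Fin 3 → ℝ, γ 0 = x₀ ∧ ∀ t : ℝ, 0 ≤ t → HasDerivAt γ (V3 (γ t)) t := by
  set S := ∑ i, x₀ i ^ 2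
  have hS : 0 ≤ S := Finset.sum_nonneg fun i _ ↦ sq_nonneg _
  let χ : ContDiffBump (0 : Fin 3 → ℝ) := ⟨1 + S, 2 + S, by positivity, by linarith⟩
  let W : (Fin 3 → ℝ) → Fin 3 → ℝ := fun x ↦ χ x • V3 x
  have hsmooth : ContDiff ℝ 1 W := χ.contDiff.smul contDiff_V3
  have hsupp : HasCompactSupport W := χ.hasCompactSupport.smul_right
  obtain ⟨K, hK⟩ := hsmooth.lipschitzWith_of_hasCompactSupport hsupp one_ne_zero
  obtain ⟨C, hC⟩ := hsmooth.continuous.bounded_above_of_compact_support hsupp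
  obtain ⟨γ, hγ0, hγ⟩ := exists_global_integralCurve hK hC x₀
  have hW : ∀ x, ∑ i, x i * W x i ≤ 0 := fun x ↦ by
    have : ∑ i, x i * W x i = χ x * ∑ i, x i * V3 x i := by
      simp only [W, Pi.smul_apply, smul_eq_mul, Finset.mul_sum, mul_left_comm]
    rw [this]
    exact mul_nonpos_of_nonneg_of_nonpos χ.nonneg (sum_mul_V3_nonpos x)
  refine ⟨γ, hγ0, fun t ht ↦ ?_⟩
  have hle : ∑ i, γ t i ^ 2 ≤ S := by
    simpa only [hγ0] using antitone_sum_sq_of_integralCurve hW hγ ht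
  have hχ : χ (γ t) = 1 := χ.one_of_mem_closedBall <| mem_closedBall_zero_iff.mpr <|
    (norm_le_one_add_sum_sq _).trans (by linarith)
  simpa only [W, hχ, one_smul] using hγ t
end

section
/- Let a ≥ b ≥ c ≥ 0 be real numbers with a² + b² + c² = 3, let g_{a,b,c} be the associated 7-dimensional solvable Lie algebra, and let Q = Diag(−4b²+4, −4c²+4, −2, −2, −2, −2, −4a²+4) with respect to the basis e₁,…,e₇. Then there exist k ∈ ℝ and a derivation D of g_{a,b,c} with Q = k·I + (1/2)(D + Dᵀ) (transpose with respect to the inner product making e₁,…,e₇ orthonormal) if and only if (a,b,c) equals (1,1,1) (with k = 0), or (√(3/2), √(3/2), 0) (with k = −2), or (√3, 0, 0) (with k = −8). -/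
/-- The bracket of the solvable Lie algebra `g_{a,b,c}` on `ℝ⁷` (basis `e₁,…,e₇` ↦ indices
`0,…,6`): `n = span(e₃,e₄,e₅,e₆)` is an abelian ideal, `e₁,e₂,e₇` pairwise commute, and
`ad e₇|_n = Diag(a,a,−a,−a)`, `ad e₁|_n = Diag(b,−b,b,−b)`, `ad e₂|_n = Diag(c,−c,−c,c)`,
extended bilinearly. -/
noncomputable def gABCBracket (a b c : ℝ) (x y : Fin 7 → ℝ) : Fin 7 → ℝ :=
  ![0, 0,
    a * (x 6 * y 2 - x 2 * y 6) + b * (x 0 * y 2 - x 2 * y 0) + c * (x 1 * y 2 - x 2 * y 1),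
    a * (x 6 * y 3 - x 3 * y 6) - b * (x 0 * y 3 - x 3 * y 0) - c * (x 1 * y 3 - x 3 * y 1),
    -a * (x 6 * y 4 - x 4 * y 6) + b * (x 0 * y 4 - x 4 * y 0) - c * (x 1 * y 4 - x 4 * y 1),
    -a * (x 6 * y 5 - x 5 * y 6) - b * (x 0 * y 5 - x 5 * y 0) + c * (x 1 * y 5 - x 5 * y 1),
    0]

/-- The operator `Q_{dτ} = Diag(−4b²+4, −4c²+4, −2, −2, −2, −2, −4a²+4)` of the closed
`G₂`-structure on `G_{a,b,c}`, as a matrix in the basis `e₁,…,e₇`. -/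
noncomputable def Qabc (a b c : ℝ) : Matrix (Fin 7) (Fin 7) ℝ :=
  Matrix.diagonal ![-4*b^2 + 4, -4*c^2 + 4, -2, -2, -2, -2, -4*a^2 + 4]

/-- A matrix `D` is a derivation of `g_{a,b,c}`. -/
def IsDerivABC (a b c : ℝ) (D : Matrix (Fin 7) (Fin 7) ℝ) : Prop :=
  ∀ x y : Fin 7 → ℝ,
    D.mulVec (gABCBracket a b c x y) =
      gABCBracket a b c (D.mulVec x) y + gABCBracket a b c x (D.mulVec y)

/-- A diagonal matrix is a derivation as soon as it kills the part of `span(e₁,e₂,e₇)` acting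
nontrivially on `n`. -/
theorem isDerivABC_diagonal {a b c : ℝ} {d : Fin 7 → ℝ} (h0 : b * d 0 = 0) (h1 : c * d 1 = 0)
    (h6 : a * d 6 = 0) : IsDerivABC a b c (Matrix.diagonal d) := by
  intro x y
  ext i
  fin_cases i <;> simp [gABCBracket, Matrix.mulVec_diagonal]
  · linear_combination (x 2 * y 6 - x 6 * y 2) * h6 + (x 2 * y 0 - x 0 * y 2) * h0
      + (x 2 * y 1 - x 1 * y 2) * h1
  · linear_combination (x 3 * y 6 - x 6 * y 3) * h6 - (x 3 * y 0 - x 0 * y 3) * h0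
      - (x 3 * y 1 - x 1 * y 3) * h1
  · linear_combination -(x 4 * y 6 - x 6 * y 4) * h6 + (x 4 * y 0 - x 0 * y 4) * h0
      - (x 4 * y 1 - x 1 * y 4) * h1
  · linear_combination -(x 5 * y 6 - x 6 * y 5) * h6 - (x 5 * y 0 - x 0 * y 5) * h0
      + (x 5 * y 1 - x 1 * y 5) * h1

/-- Comparing the `n`-diagonal part of `D[eⱼ,eᵢ] = [Deⱼ,eᵢ] + [eⱼ,Deᵢ]` for `eⱼ ∈ span(e₁,e₂,e₇)`
shows that `ad (Deⱼ)` vanishes on `n`. -/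
theorem IsDerivABC.mul_apply_eq_zero {a b c : ℝ} {D : Matrix (Fin 7) (Fin 7) ℝ}
    (hD : IsDerivABC a b c D) {j : Fin 7} (hj : j = 0 ∨ j = 1 ∨ j = 6) :
    b * D 0 j = 0 ∧ c * D 1 j = 0 ∧ a * D 6 j = 0 := by
  have e2 := congrFun (hD (Pi.single j 1) (Pi.single 2 1)) 2
  have e3 := congrFun (hD (Pi.single j 1) (Pi.single 3 1)) 3
  have e4 := congrFun (hD (Pi.single j 1) (Pi.single 4 1)) 4
  rcases hj with rfl | rfl | rfl <;>
    simp [gABCBracket, Matrix.mulVec, dotProduct, Fin.sum_univ_succ, Pi.single_apply]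
      at e2 e3 e4 <;>
    refine ⟨?_, ?_, ?_⟩ <;> linarith

/-- A diagonal soliton equation is solved by the diagonal derivation `Q - k I` whenever `k`
agrees with `Q` on the part of `span(e₁,e₂,e₇)` acting nontrivially on `n`. -/
theorem exists_isDerivABC_of_mul_eq_zero {a b c k : ℝ} (hb : b * (-4 * b ^ 2 + 4 - k) = 0)
    (hc : c * (-4 * c ^ 2 + 4 - k) = 0) (ha : a * (-4 * a ^ 2 + 4 - k) = 0) :
    ∃ D : Matrix (Fin 7) (Fin 7) ℝ, IsDerivABC a b c D ∧
      Qabc a b c = k • (1 : Matrix (Fin 7) (Fin 7) ℝ) + (1/2 : ℝ) • (D + D.transpose) := by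
  refine ⟨Matrix.diagonal fun i => Qabc a b c i i - k, isDerivABC_diagonal ?_ ?_ ?_, ?_⟩
  · simpa [Qabc] using hb
  · simpa [Qabc] using hc
  · simpa [Qabc] using ha
  · ext i j
    rcases eq_or_ne i j with rfl | hij
    · simp
      ring
    · simp [Qabc, hij]

/-- Conversely, the soliton equation forces `k` to agree with `Q` there. -/
theorem IsDerivABC.mul_eq_zero {a b c k : ℝ} {D : Matrix (Fin 7) (Fin 7) ℝ}
    (hD : IsDerivABC a b c D)
    (hQ : Qabc a b c = k • (1 : Matrix (Fin 7) (Fin 7) ℝ) + (1/2 : ℝ) • (D + D.transpose)) :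
    b * (-4 * b ^ 2 + 4 - k) = 0 ∧ c * (-4 * c ^ 2 + 4 - k) = 0 ∧
      a * (-4 * a ^ 2 + 4 - k) = 0 := by
  have diag (i : Fin 7) : Qabc a b c i i - k = D i i := by
    have h := congrFun (congrFun hQ i) i
    simp only [Matrix.add_apply, Matrix.smul_apply, Matrix.one_apply_eq, Matrix.transpose_apply,
      smul_eq_mul] at h
    linarith
  have d0 := diag 0
  have d1 := diag 1
  have d6 := diag 6
  simp only [Qabc, Matrix.diagonal_apply_eq] at d0 d1 d6
  refine ⟨?_, ?_, ?_⟩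
  · rw [← (hD.mul_apply_eq_zero (j := 0) (by simp)).1, ← d0]; rfl
  · rw [← (hD.mul_apply_eq_zero (j := 1) (by simp)).2.1, ← d1]; rfl
  · rw [← (hD.mul_apply_eq_zero (j := 6) (by simp)).2.2, ← d6]; rfl

/-- For `a ≥ b ≥ c ≥ 0` with `a² + b² + c² = 3`, there exist `k ∈ ℝ`
and a derivation `D` of `g_{a,b,c}` with `Q = k·I + (1/2)(D + Dᵀ)` iff `(a,b,c)` equals
`(1,1,1)` (with `k = 0`), `(√(3/2), √(3/2), 0)` (with `k = −2`), or `(√3, 0, 0)`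
(with `k = −8`). -/
theorem stmt_13 (a b c : ℝ) (h1 : c ≤ b) (h2 : b ≤ a) (h3 : 0 ≤ c)
    (h4 : a^2 + b^2 + c^2 = 3) :
    ((∃ k : ℝ, ∃ D : Matrix (Fin 7) (Fin 7) ℝ, IsDerivABC a b c D ∧
        Qabc a b c = k • (1 : Matrix (Fin 7) (Fin 7) ℝ) + (1/2 : ℝ) • (D + D.transpose)) ↔
      ((a = 1 ∧ b = 1 ∧ c = 1) ∨
       (a = Real.sqrt (3/2) ∧ b = Real.sqrt (3/2) ∧ c = 0) ∨
       (a = Real.sqrt 3 ∧ b = 0 ∧ c = 0))) ∧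
    (a = 1 ∧ b = 1 ∧ c = 1 →
      ∃ D : Matrix (Fin 7) (Fin 7) ℝ, IsDerivABC a b c D ∧
        Qabc a b c = (0 : ℝ) • (1 : Matrix (Fin 7) (Fin 7) ℝ) +
          (1/2 : ℝ) • (D + D.transpose)) ∧
    (a = Real.sqrt (3/2) ∧ b = Real.sqrt (3/2) ∧ c = 0 →
      ∃ D : Matrix (Fin 7) (Fin 7) ℝ, IsDerivABC a b c D ∧
        Qabc a b c = (-2 : ℝ) • (1 : Matrix (Fin 7) (Fin 7) ℝ) +
          (1/2 : ℝ) • (D + D.transpose)) ∧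
    (a = Real.sqrt 3 ∧ b = 0 ∧ c = 0 →
      ∃ D : Matrix (Fin 7) (Fin 7) ℝ, IsDerivABC a b c D ∧
        Qabc a b c = (-8 : ℝ) • (1 : Matrix (Fin 7) (Fin 7) ℝ) +
          (1/2 : ℝ) • (D + D.transpose)) := by
  have hsol1 : a = 1 ∧ b = 1 ∧ c = 1 →
      ∃ D : Matrix (Fin 7) (Fin 7) ℝ, IsDerivABC a b c D ∧
        Qabc a b c = (0 : ℝ) • (1 : Matrix (Fin 7) (Fin 7) ℝ) +
          (1/2 : ℝ) • (D + D.transpose) := by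
    rintro ⟨rfl, rfl, rfl⟩
    apply exists_isDerivABC_of_mul_eq_zero <;> norm_num
  have hsol2 : a = Real.sqrt (3/2) ∧ b = Real.sqrt (3/2) ∧ c = 0 →
      ∃ D : Matrix (Fin 7) (Fin 7) ℝ, IsDerivABC a b c D ∧
        Qabc a b c = (-2 : ℝ) • (1 : Matrix (Fin 7) (Fin 7) ℝ) +
          (1/2 : ℝ) • (D + D.transpose) := by
    rintro ⟨rfl, rfl, rfl⟩
    have hs : Real.sqrt (3/2) ^ 2 = 3/2 := Real.sq_sqrt (by norm_num)
    apply exists_isDerivABC_of_mul_eq_zero <;> first | simp only [zero_mul] | (rw [hs]; ring)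
  have hsol3 : a = Real.sqrt 3 ∧ b = 0 ∧ c = 0 →
      ∃ D : Matrix (Fin 7) (Fin 7) ℝ, IsDerivABC a b c D ∧
        Qabc a b c = (-8 : ℝ) • (1 : Matrix (Fin 7) (Fin 7) ℝ) +
          (1/2 : ℝ) • (D + D.transpose) := by
    rintro ⟨rfl, rfl, rfl⟩
    have hs : Real.sqrt 3 ^ 2 = 3 := Real.sq_sqrt (by norm_num)
    apply exists_isDerivABC_of_mul_eq_zero <;> first | simp only [zero_mul] | (rw [hs]; ring)
  refine ⟨⟨?_, ?_⟩, hsol1, hsol2, hsol3⟩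
  · rintro ⟨k, D, hD, hQ⟩
    obtain ⟨hb, hc, ha⟩ := hD.mul_eq_zero hQ
    have ha0 : 0 < a := by nlinarith
    have hak := (mul_eq_zero.mp ha).resolve_left ha0.ne'
    rcases (h3.trans h1).eq_or_lt with hb0 | hb0
    · have hc0 : c = 0 := by linarith
      subst hb0 hc0
      exact Or.inr (Or.inr ⟨((Real.sqrt_eq_iff_eq_sq (by norm_num) ha0.le).2 (by linarith)).symm,
        rfl, rfl⟩)
    · have hbk := (mul_eq_zero.mp hb).resolve_left hb0.ne'
      rcases h3.eq_or_lt with hc0 | hc0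
      · subst hc0
        exact Or.inr (Or.inl
          ⟨((Real.sqrt_eq_iff_eq_sq (by norm_num) ha0.le).2 (by linarith)).symm,
            ((Real.sqrt_eq_iff_eq_sq (by norm_num) hb0.le).2 (by linarith)).symm, rfl⟩)
      · have hck := (mul_eq_zero.mp hc).resolve_left hc0.ne'
        exact Or.inl ⟨by nlinarith, by nlinarith, by nlinarith⟩
  · rintro (h | h | h)
    · exact ⟨0, hsol1 h⟩
    · exact ⟨-2, hsol2 h⟩
    · exact ⟨-8, hsol3 h⟩
end

section
/- The 7-dimensional real Lie algebra g_{1,1,1} (the member a = b = c = 1 of the family g_{a,b,c}) is not isomorphic to the 7-dimensional real Lie algebra g₁ (the member a = 1 of the family g_a). -/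
/-- `g_{a,b,c}` is metabelian: its derived algebra lies in the abelian ideal `n`. -/
theorem gABCBracket_gABCBracket_gABCBracket (a b c : ℝ) (x y z w : Fin 7 → ℝ) :
    gABCBracket a b c (gABCBracket a b c x y) (gABCBracket a b c z w) = 0 := by
  ext i
  fin_cases i <;> simp [gABCBracket]

/-- `g₁` is not metabelian: `e₁ = [e₇,e₁]` and `e₄ = -2[e₇,e₄]` do not commute. -/
theorem exists_gABracket_gABracket_gABracket_ne_zero :
    ∃ x y z : Fin 7 → ℝ, gABracket 1 (gABracket 1 x y) (gABracket 1 x z) ≠ 0 := by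
  refine ⟨![0, 0, 0, 0, 0, 0, 1], ![1, 0, 0, 0, 0, 0, 0], ![0, 0, 0, 1, 0, 0, 0], fun h => ?_⟩
  have h4 := congrFun h 4
  simp [gABracket] at h4
  norm_num at h4

/-- The Lie algebra `g_{1,1,1}` (member `a = b = c = 1` of the family
`g_{a,b,c}`) is not isomorphic, as a real Lie algebra, to `g₁` (member `a = 1` of the
family `g_a`): no linear equivalence of `ℝ⁷` intertwines the two brackets. -/
theorem stmt_14 :
    ¬ ∃ e : (Fin 7 → ℝ) ≃ₗ[ℝ] (Fin 7 → ℝ),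
      ∀ x y : Fin 7 → ℝ, e (gABCBracket 1 1 1 x y) = gABracket 1 (e x) (e y) := by
  rintro ⟨e, he⟩
  obtain ⟨x, y, z, hne⟩ := exists_gABracket_gABracket_gABracket_ne_zero
  apply hne
  obtain ⟨x, rfl⟩ := e.surjective x
  obtain ⟨y, rfl⟩ := e.surjective y
  obtain ⟨z, rfl⟩ := e.surjective z
  rw [← he, ← he, ← he, gABCBracket_gABCBracket_gABCBracket, map_zero]
end

section
/- Let s be the 7-dimensional real Lie algebra with basis f₁, f₂, f₃, e₄, e₅, e₆, e₇ whose only nonzero brackets among basis vectors (up to antisymmetry) are [f₁,f₂]=−2f₂, [f₁,f₃]=−2f₃, [f₁,e₄]=−e₄, [f₁,e₅]=−e₅, [f₁,e₆]=e₆, [f₁,e₇]=e₇, [f₂,e₆]=e₅, [f₂,e₇]=e₄, [f₃,e₆]=e₄, [f₃,e₇]=−e₅. Then s is isomorphic, as a real Lie algebra, to g₁ (the member a = 1 of the family g_a). -/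
/-- The bracket of the solvable Lie algebra `s` on `ℝ⁷` (basis `f₁,f₂,f₃,e₄,e₅,e₆,e₇` ↦
indices `0,…,6`): `[f₁,f₂]=−2f₂`, `[f₁,f₃]=−2f₃`, `[f₁,e₄]=−e₄`, `[f₁,e₅]=−e₅`,
`[f₁,e₆]=e₆`, `[f₁,e₇]=e₇`, `[f₂,e₆]=e₅`, `[f₂,e₇]=e₄`, `[f₃,e₆]=e₄`, `[f₃,e₇]=−e₅`,
extended bilinearly. -/
noncomputable def sBracket (x y : Fin 7 → ℝ) : Fin 7 → ℝ :=
  ![0,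
    -2 * (x 0 * y 1 - x 1 * y 0),
    -2 * (x 0 * y 2 - x 2 * y 0),
    -(x 0 * y 3 - x 3 * y 0) + (x 1 * y 6 - x 6 * y 1) + (x 2 * y 5 - x 5 * y 2),
    -(x 0 * y 4 - x 4 * y 0) + (x 1 * y 5 - x 5 * y 1) - (x 2 * y 6 - x 6 * y 2),
    x 0 * y 5 - x 5 * y 0,
    x 0 * y 6 - x 6 * y 0]

/-- The linear isomorphism `f₁ ↦ -2e₇`, `f₂ ↦ e₁`, `f₃ ↦ e₂`, `e₄ ↦ -e₅`, `e₅ ↦ -e₆`,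
`e₆ ↦ e₃`, `e₇ ↦ e₄`. -/
noncomputable def sEquivG : (Fin 7 → ℝ) ≃ₗ[ℝ] (Fin 7 → ℝ) where
  toFun x := ![x 1, x 2, x 5, x 6, -x 3, -x 4, -2 * x 0]
  invFun y := ![-(1/2) * y 6, y 0, y 1, -y 4, -y 5, y 2, y 3]
  map_add' x y := by ext i; fin_cases i <;> simp <;> ring
  map_smul' c x := by ext i; fin_cases i <;> simp; ring
  left_inv x := by ext i; fin_cases i <;> simp
  right_inv x := by ext i; fin_cases i <;> simp

theorem sEquivG_apply (x : Fin 7 → ℝ) :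
    sEquivG x = ![x 1, x 2, x 5, x 6, -x 3, -x 4, -2 * x 0] := rfl

/-- The Lie algebra `s` (of the solvable group acting simply
transitively in Bryant's example) is isomorphic, as a real Lie algebra, to `g₁`
(member `a = 1` of the family `g_a`). -/
theorem stmt_15 :
    ∃ e : (Fin 7 → ℝ) ≃ₗ[ℝ] (Fin 7 → ℝ),
      ∀ x y : Fin 7 → ℝ, e (sBracket x y) = gABracket 1 (e x) (e y) := by
  refine ⟨sEquivG, fun x y => ?_⟩
  ext i
  fin_cases i <;> simp [sEquivG_apply, sBracket, gABracket] <;> ring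
end

section
/- For every real number a, the alternating 3-form φ = e¹∧e²∧e⁷ + e³∧e⁴∧e⁷ + e⁵∧e⁶∧e⁷ + e¹∧e³∧e⁵ − e¹∧e⁴∧e⁶ − e²∧e³∧e⁶ − e²∧e⁴∧e⁵ on g_a is closed with respect to the Chevalley–Eilenberg differential: for all x, y, z, w ∈ g_a, φ([x,y],z,w) − φ([x,z],y,w) + φ([x,w],y,z) + φ([y,z],x,w) − φ([y,w],x,z) + φ([z,w],x,y) = 0. -/
/-- `wedge3 i j k x y z` is the value `(eⁱ ∧ eʲ ∧ eᵏ)(x,y,z)` of a basic alternating 3-form. -/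
noncomputable def wedge3 (i j k : Fin 7) (x y z : Fin 7 → ℝ) : ℝ :=
  x i * (y j * z k - y k * z j) - x j * (y i * z k - y k * z i) + x k * (y i * z j - y j * z i)

/-- The canonical positive 3-form
`φ = e¹²⁷ + e³⁴⁷ + e⁵⁶⁷ + e¹³⁵ − e¹⁴⁶ − e²³⁶ − e²⁴⁵` on `ℝ⁷`
(indices shifted down by one). -/
noncomputable def phi3 (x y z : Fin 7 → ℝ) : ℝ :=
  wedge3 0 1 6 x y z + wedge3 2 3 6 x y z + wedge3 4 5 6 x y z + wedge3 0 2 4 x y z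
    - wedge3 0 3 5 x y z - wedge3 1 2 5 x y z - wedge3 1 3 4 x y z

/-- For every real `a`, the positive 3-form
`φ = e¹²⁷ + e³⁴⁷ + e⁵⁶⁷ + e¹³⁵ − e¹⁴⁶ − e²³⁶ − e²⁴⁵` on `g_a` is closed with respect to
the Chevalley–Eilenberg differential. -/
theorem stmt_16 (a : ℝ) (x y z w : Fin 7 → ℝ) :
    phi3 (gABracket a x y) z w - phi3 (gABracket a x z) y w + phi3 (gABracket a x w) y z
      + phi3 (gABracket a y z) x w - phi3 (gABracket a y w) x z
      + phi3 (gABracket a z w) x y = 0 := by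
  simp only [phi3, wedge3, gABracket, Matrix.cons_val]
  ring
end

section
/- For all real numbers a, b, c, the alternating 3-form φ = e¹∧e²∧e⁷ + e³∧e⁴∧e⁷ + e⁵∧e⁶∧e⁷ + e¹∧e³∧e⁵ − e¹∧e⁴∧e⁶ − e²∧e³∧e⁶ − e²∧e⁴∧e⁵ on g_{a,b,c} is closed with respect to the Chevalley–Eilenberg differential: for all x, y, z, w ∈ g_{a,b,c}, φ([x,y],z,w) − φ([x,z],y,w) + φ([x,w],y,z) + φ([y,z],x,w) − φ([y,w],x,z) + φ([z,w],x,y) = 0. -/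
/-- For all reals `a, b, c`, the positive 3-form
`φ = e¹²⁷ + e³⁴⁷ + e⁵⁶⁷ + e¹³⁵ − e¹⁴⁶ − e²³⁶ − e²⁴⁵` on `g_{a,b,c}` is closed with
respect to the Chevalley–Eilenberg differential. -/
theorem stmt_17 (a b c : ℝ) (x y z w : Fin 7 → ℝ) :
    phi3 (gABCBracket a b c x y) z w - phi3 (gABCBracket a b c x z) y w
      + phi3 (gABCBracket a b c x w) y z + phi3 (gABCBracket a b c y z) x w
      - phi3 (gABCBracket a b c y w) x z + phi3 (gABCBracket a b c z w) x y = 0 := by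
  simp [phi3, wedge3, gABCBracket]
  ring
end

section
/- Let φ = e¹∧e²∧e⁷ + e³∧e⁴∧e⁷ + e⁵∧e⁶∧e⁷ + e¹∧e³∧e⁵ − e¹∧e⁴∧e⁶ − e²∧e³∧e⁶ − e²∧e⁴∧e⁵ be the canonical alternating 3-form on ℝ⁷, and for a linear map A : ℝ⁷ → ℝ⁷ define θ(A)φ to be the alternating 3-form (x,y,z) ↦ −φ(Ax,y,z) − φ(x,Ay,z) − φ(x,y,Az). Then the subspace g₂ = {A ∈ End(ℝ⁷) : θ(A)φ = 0} has dimension 14 over ℝ. -/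
/-- The linear map `A ↦ θ(A)φ`, where
`(θ(A)φ)(x,y,z) = −φ(Ax,y,z) − φ(x,Ay,z) − φ(x,y,Az)`. -/
noncomputable def thetaPhi :
    Module.End ℝ (Fin 7 → ℝ) →ₗ[ℝ] ((Fin 7 → ℝ) → (Fin 7 → ℝ) → (Fin 7 → ℝ) → ℝ) where
  toFun A := fun x y z => -phi3 (A x) y z - phi3 x (A y) z - phi3 x y (A z)
  map_add' A B := by
    funext x y z
    simp only [LinearMap.add_apply, phi3, wedge3, Pi.add_apply]
    ring
  map_smul' r A := by
    funext x y z
    simp only [LinearMap.smul_apply, phi3, wedge3, Pi.smul_apply, smul_eq_mul,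
      RingHom.id_apply]
    ring

/-- The skew-symmetric matrices whose contractions with `φ` vanish, in coordinates: each of the seven
components of the contraction involves three entries, the third of which is determined by the other
two. -/
def g2Matrix : (Fin 14 → ℝ) →ₗ[ℝ] Matrix (Fin 7) (Fin 7) ℝ where
  toFun t := !![
    0, t 12, t 9, t 10, t 4 + t 5, t 6, -t 2 - t 3;
    -t 12, 0, t 11, t 8 + t 9, t 7, t 5, t 0;
    -t 9, -t 11, 0, t 13, t 1, t 2, t 6 + t 7;
    -t 10, -t 8 - t 9, -t 13, 0, t 3, t 0 + t 1, t 4;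
    -t 4 - t 5, -t 7, -t 1, -t 3, 0, -t 12 - t 13, -t 10 - t 11;
    -t 6, -t 5, -t 2, -t 0 - t 1, t 12 + t 13, 0, t 8;
    t 2 + t 3, -t 0, -t 6 - t 7, -t 4, t 10 + t 11, -t 8, 0]
  map_add' s t := by
    ext i j
    fin_cases i <;> fin_cases j <;> simp <;> ring
  map_smul' r t := by
    ext i j
    fin_cases i <;> fin_cases j <;> simp <;> ring

lemma g2Matrix_injective : Function.Injective g2Matrix := by
  intro s t h
  have entry (i j : Fin 7) : g2Matrix s i j = g2Matrix t i j := by rw [h]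
  ext i
  fin_cases i
  · simpa [g2Matrix] using entry 1 6
  · simpa [g2Matrix] using entry 2 4
  · simpa [g2Matrix] using entry 2 5
  · simpa [g2Matrix] using entry 3 4
  · simpa [g2Matrix] using entry 3 6
  · simpa [g2Matrix] using entry 1 5
  · simpa [g2Matrix] using entry 0 5
  · simpa [g2Matrix] using entry 1 4
  · simpa [g2Matrix] using entry 5 6
  · simpa [g2Matrix] using entry 0 2
  · simpa [g2Matrix] using entry 0 3
  · simpa [g2Matrix] using entry 1 2
  · simpa [g2Matrix] using entry 0 1
  · simpa [g2Matrix] using entry 2 3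

lemma thetaPhi_toLin'_g2Matrix (t : Fin 14 → ℝ) : thetaPhi (Matrix.toLin' (g2Matrix t)) = 0 := by
  funext x y z
  simp [thetaPhi, phi3, wedge3, Matrix.toLin'_apply, Matrix.mulVec, dotProduct, Fin.sum_univ_succ,
    g2Matrix]
  ring

lemma phi3_derivation_single {A : Module.End ℝ (Fin 7 → ℝ)} (hA : thetaPhi A = 0)
    (i j k : Fin 7) :
    phi3 (fun l => LinearMap.toMatrix' A l i) (Pi.single j 1) (Pi.single k 1)
      + phi3 (Pi.single i 1) (fun l => LinearMap.toMatrix' A l j) (Pi.single k 1)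
      + phi3 (Pi.single i 1) (Pi.single j 1) (fun l => LinearMap.toMatrix' A l k) = 0 := by
  have h : thetaPhi A (Pi.single i 1) (Pi.single j 1) (Pi.single k 1) = 0 := by rw [hA]; rfl
  simp only [thetaPhi, LinearMap.coe_mk, AddHom.coe_mk] at h
  simp only [LinearMap.toMatrix'_apply]
  linarith

set_option maxHeartbeats 1000000 in
lemma exists_g2Matrix_eq_toMatrix' {A : Module.End ℝ (Fin 7 → ℝ)} (hA : thetaPhi A = 0) :
    ∃ t, g2Matrix t = LinearMap.toMatrix' A := by
  have eqn := phi3_derivation_single hA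
  generalize LinearMap.toMatrix' A = M at eqn ⊢
  simp only [phi3, wedge3] at eqn
  have h012 := eqn 0 1 2
  have h013 := eqn 0 1 3
  have h014 := eqn 0 1 4
  have h015 := eqn 0 1 5
  have h016 := eqn 0 1 6
  have h023 := eqn 0 2 3
  have h024 := eqn 0 2 4
  have h025 := eqn 0 2 5
  have h026 := eqn 0 2 6
  have h034 := eqn 0 3 4
  have h035 := eqn 0 3 5
  have h036 := eqn 0 3 6
  have h045 := eqn 0 4 5
  have h046 := eqn 0 4 6
  have h056 := eqn 0 5 6
  have h123 := eqn 1 2 3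
  have h124 := eqn 1 2 4
  have h125 := eqn 1 2 5
  have h126 := eqn 1 2 6
  have h134 := eqn 1 3 4
  have h135 := eqn 1 3 5
  have h136 := eqn 1 3 6
  have h145 := eqn 1 4 5
  have h146 := eqn 1 4 6
  have h156 := eqn 1 5 6
  have h234 := eqn 2 3 4
  have h235 := eqn 2 3 5
  have h236 := eqn 2 3 6
  have h245 := eqn 2 4 5
  have h246 := eqn 2 4 6
  have h256 := eqn 2 5 6
  have h345 := eqn 3 4 5
  have h346 := eqn 3 4 6
  have h356 := eqn 3 5 6
  have h456 := eqn 4 5 6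
  simp at h012 h013 h014 h015 h016 h023 h024 h025 h026 h034 h035 h036 h045 h046 h056 h123 h124
  simp at h125 h126 h134 h135 h136 h145 h146 h156 h234 h235 h236 h245 h246 h256 h345 h346 h356 h456
  refine ⟨![M 1 6, M 2 4, M 2 5, M 3 4, M 3 6, M 1 5, M 0 5, M 1 4, M 5 6, M 0 2, M 0 3, M 1 2,
    M 0 1, M 2 3], ?_⟩
  ext i j
  fin_cases i <;> fin_cases j <;> simp [g2Matrix] <;> linarith

/-- The subspace `g₂ = {A ∈ End(ℝ⁷) : θ(A)φ = 0}` (the stabilizer Lie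
algebra of the positive 3-form `φ`) has dimension `14` over `ℝ`. -/
theorem stmt_18 : Module.finrank ℝ (LinearMap.ker thetaPhi) = 14 := by
  let f : (Fin 14 → ℝ) →ₗ[ℝ] Module.End ℝ (Fin 7 → ℝ) := Matrix.toLin'.toLinearMap ∘ₗ g2Matrix
  have hf : Function.Injective f := Matrix.toLin'.injective.comp g2Matrix_injective
  have hrange : LinearMap.range f = LinearMap.ker thetaPhi := by
    ext A
    rw [LinearMap.mem_range, LinearMap.mem_ker]
    constructor
    · rintro ⟨t, rfl⟩
      exact thetaPhi_toLin'_g2Matrix t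
    · intro hA
      obtain ⟨t, ht⟩ := exists_g2Matrix_eq_toMatrix' hA
      exact ⟨t, by simp [f, ht]⟩
  rw [← hrange, LinearMap.finrank_range_of_inj hf, Module.finrank_fin_fun]
end
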